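/- Let T > 0, let Z = {z ∈ ℝ² : ‖z‖ ≤ R_Z} with R_Z > 0, let τ ∈ [0,T], and let z : [τ,T] → Z be measurable. Let x : [τ,T] → ℝ³ be the horizontal curve with horizontal velocity z and initial point ξ ∈ ℝ³. Then d_G(ξ, x(t)) ≤ 3 R_Z (t − τ) for every t ∈ [τ,T]. -/

import Mathlib

open MeasureTheory Set

noncomputable section

/-- Heisenberg group law on ℝ³. -/
def hMul (a b : ℝ × ℝ × ℝ) : ℝ × ℝ × ℝ :=
  (a.1 + b.1, a.2.1 + b.2.1, a.2.2 + b.2.2 + (a.1 * b.2.1 - b.1 * a.2.1) / 2)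

/-- Korányi gauge. -/
def gaugeH (a : ℝ × ℝ × ℝ) : ℝ :=
  ((a.1 ^ 2 + a.2.1 ^ 2) ^ 2 + a.2.2 ^ 2) ^ ((1 : ℝ) / 4)

/-- Korányi distance `d_G(x,x') = ‖(x')⁻¹ ∘ x‖_G` (the inverse is `-x'`). -/
def dG (a b : ℝ × ℝ × ℝ) : ℝ := gaugeH (hMul (-b) a)

/-- Euclidean norm on ℝ². -/
def norm2 (v : ℝ × ℝ) : ℝ := Real.sqrt (v.1 ^ 2 + v.2 ^ 2)

/-- Euclidean dot product on ℝ². -/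
def dot2 (v w : ℝ × ℝ) : ℝ := v.1 * w.1 + v.2 * w.2

/-- Euclidean norm on ℝ³. -/
def norm3 (v : ℝ × ℝ × ℝ) : ℝ := Real.sqrt (v.1 ^ 2 + v.2.1 ^ 2 + v.2.2 ^ 2)

/-- The horizontal dynamics `f^ℍ(x,z) = (z₁, z₂, (z₂x₁ - z₁x₂)/2)`. -/
def fH (x : ℝ × ℝ × ℝ) (z : ℝ × ℝ) : ℝ × ℝ × ℝ :=
  (z.1, z.2, (z.2 * x.1 - z.1 * x.2.1) / 2)

/-- `x` is the horizontal curve on `[a,b]` with horizontal velocity `z` and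
initial point `ξ`, i.e. `x(t) = ξ + ∫_a^t f^ℍ(x(s), z(s)) ds`. -/
def IsHorizontalCurveOn (a b : ℝ) (z : ℝ → ℝ × ℝ) (ξ : ℝ × ℝ × ℝ)
    (x : ℝ → ℝ × ℝ × ℝ) : Prop :=
  ∀ t ∈ Set.Icc a b, x t = ξ + ∫ s in a..t, fH (x s) (z s)

lemma dG_self (a : ℝ × ℝ × ℝ) : dG a a = 0 := by
  have h : hMul (-a) a = 0 := by
    ext <;> simp [hMul]
  simp [dG, h, gaugeH]

lemma abs_le_norm2 (v : ℝ × ℝ) : |v.1| ≤ norm2 v ∧ |v.2| ≤ norm2 v :=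
  ⟨Real.abs_le_sqrt (by nlinarith [sq_nonneg v.2]),
    Real.abs_le_sqrt (by nlinarith [sq_nonneg v.1])⟩

lemma gaugeH_le {a : ℝ × ℝ × ℝ} {L : ℝ} (hL : 0 ≤ L) (h₁ : |a.1| ≤ L) (h₂ : |a.2.1| ≤ L)
    (h₃ : |a.2.2| ≤ L ^ 2) : gaugeH a ≤ 3 * L := by
  have q₁ : a.1 ^ 2 ≤ L ^ 2 := sq_le_sq' (abs_le.1 h₁).1 (abs_le.1 h₁).2
  have q₂ : a.2.1 ^ 2 ≤ L ^ 2 := sq_le_sq' (abs_le.1 h₂).1 (abs_le.1 h₂).2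
  have q₃ : a.2.2 ^ 2 ≤ (L ^ 2) ^ 2 := sq_le_sq' (abs_le.1 h₃).1 (abs_le.1 h₃).2
  have q₄ : (a.1 ^ 2 + a.2.1 ^ 2) ^ 2 ≤ (2 * L ^ 2) ^ 2 :=
    pow_le_pow_left₀ (by positivity) (by linarith) 2
  have key : (a.1 ^ 2 + a.2.1 ^ 2) ^ 2 + a.2.2 ^ 2 ≤ (3 * L) ^ 4 := by
    nlinarith [pow_nonneg hL 4]
  calc gaugeH a ≤ ((3 * L) ^ 4) ^ ((1 : ℝ) / 4) :=
        Real.rpow_le_rpow (by positivity) key (by norm_num)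
    _ = 3 * L := by
        rw [← Real.rpow_natCast, ← Real.rpow_mul (by positivity)]
        norm_num

/-- The coordinates of the integral of the horizontal dynamics. -/
lemma integral_fH {a b : ℝ} {z : ℝ → ℝ × ℝ} {x : ℝ → ℝ × ℝ × ℝ}
    (h : IntervalIntegrable (fun s => fH (x s) (z s)) volume a b) :
    ∫ s in a..b, fH (x s) (z s) = (∫ s in a..b, (z s).1, ∫ s in a..b, (z s).2,
      ∫ s in a..b, ((z s).2 * (x s).1 - (z s).1 * (x s).2.1) / 2) := by
  have e₁ := (ContinuousLinearMap.fst ℝ ℝ (ℝ × ℝ)).intervalIntegral_comp_comm h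
  have e₂ := ((ContinuousLinearMap.fst ℝ ℝ ℝ).comp
    (ContinuousLinearMap.snd ℝ ℝ (ℝ × ℝ))).intervalIntegral_comp_comm h
  have e₃ := ((ContinuousLinearMap.snd ℝ ℝ ℝ).comp
    (ContinuousLinearMap.snd ℝ ℝ (ℝ × ℝ))).intervalIntegral_comp_comm h
  exact Prod.ext e₁.symm (Prod.ext e₂.symm e₃.symm)

lemma intervalIntegrable_fH_coords {a b : ℝ} {z : ℝ → ℝ × ℝ} {x : ℝ → ℝ × ℝ × ℝ}
    (h : IntervalIntegrable (fun s => fH (x s) (z s)) volume a b) :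
    IntervalIntegrable (fun s => (z s).1) volume a b ∧
      IntervalIntegrable (fun s => (z s).2) volume a b ∧
      IntervalIntegrable (fun s => ((z s).2 * (x s).1 - (z s).1 * (x s).2.1) / 2)
        volume a b :=
  ⟨⟨h.1.fst, h.2.fst⟩, ⟨h.1.snd.fst, h.2.snd.fst⟩, ⟨h.1.snd.snd, h.2.snd.snd⟩⟩

/-- `d_G(ξ, x(t)) ≤ 3 R_Z (t - τ)` for a horizontal curve with velocity
bounded by `R_Z` and initial point `ξ`. -/
theorem stmt_1 (T RZ : ℝ) (hT : 0 < T) (hRZ : 0 < RZ)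
    (τ : ℝ) (hτ : τ ∈ Set.Icc 0 T)
    (z : ℝ → ℝ × ℝ) (hzm : Measurable z)
    (hz : ∀ t ∈ Set.Icc τ T, norm2 (z t) ≤ RZ)
    (ξ : ℝ × ℝ × ℝ) (x : ℝ → ℝ × ℝ × ℝ)
    (hx : IsHorizontalCurveOn τ T z ξ x) :
    ∀ t ∈ Set.Icc τ T, dG ξ (x t) ≤ 3 * RZ * (t - τ) := by
  intro t ht
  by_cases hint : IntervalIntegrable (fun s => fH (x s) (z s)) volume τ t
  swap
  · have hxt : x t = ξ := by
      rw [hx t ht, intervalIntegral.integral_undef hint, add_zero]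
    rw [hxt, dG_self]
    have := sub_nonneg.2 ht.1
    positivity
  have hxs : ∀ s ∈ Icc τ t, x s = ξ + (∫ r in τ..s, (z r).1, ∫ r in τ..s, (z r).2,
      ∫ r in τ..s, ((z r).2 * (x r).1 - (z r).1 * (x r).2.1) / 2) := by
    intro s hs
    rw [hx s ⟨hs.1, hs.2.trans ht.2⟩, integral_fH]
    refine hint.mono_set ?_
    rw [uIcc_of_le hs.1, uIcc_of_le ht.1]
    exact Icc_subset_Icc_right hs.2
  have hz₁ : ∀ s ∈ Icc τ t, |(z s).1| ≤ RZ ∧ |(z s).2| ≤ RZ := fun s hs =>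
    have hs' := hz s ⟨hs.1, hs.2.trans ht.2⟩
    ⟨(abs_le_norm2 _).1.trans hs', (abs_le_norm2 _).2.trans hs'⟩
  have hdisp : ∀ s ∈ Icc τ t,
      |(x s).1 - ξ.1| ≤ RZ * (t - τ) ∧ |(x s).2.1 - ξ.2.1| ≤ RZ * (t - τ) := by
    intro s hs
    have hle : RZ * |s - τ| ≤ RZ * (t - τ) := by
      rw [abs_of_nonneg (sub_nonneg.2 hs.1)]
      exact mul_le_mul_of_nonneg_left (sub_le_sub_right hs.2 _) hRZ.le
    have hmem : ∀ r ∈ uIoc τ s, r ∈ Icc τ t := by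
      intro r hr
      rw [uIoc_of_le hs.1] at hr
      exact ⟨hr.1.le, hr.2.trans hs.2⟩
    rw [hxs s hs]
    simp only [Prod.fst_add, Prod.snd_add, add_sub_cancel_left]
    exact ⟨(intervalIntegral.norm_integral_le_of_norm_le_const (f := fun r => (z r).1)
        fun r hr => (hz₁ r (hmem r hr)).1).trans hle,
      (intervalIntegral.norm_integral_le_of_norm_le_const (f := fun r => (z r).2)
        fun r hr => (hz₁ r (hmem r hr)).2).trans hle⟩
  have hL : 0 ≤ RZ * (t - τ) := mul_nonneg hRZ.le (sub_nonneg.2 ht.1)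
  have ht' : t ∈ Icc τ t := ⟨ht.1, le_rfl⟩
  obtain ⟨i₁, i₂, i₃⟩ := intervalIntegrable_fH_coords hint
  have harea : ξ.2.2 - (x t).2.2 + (ξ.1 * (x t).2.1 - (x t).1 * ξ.2.1) / 2 =
      -∫ s in τ..t, ((z s).2 * ((x s).1 - ξ.1) - (z s).1 * ((x s).2.1 - ξ.2.1)) / 2 := by
    have hsplit : ∫ s in τ..t, ((z s).2 * ((x s).1 - ξ.1) - (z s).1 * ((x s).2.1 - ξ.2.1)) / 2
        = (∫ s in τ..t, ((z s).2 * (x s).1 - (z s).1 * (x s).2.1) / 2)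
          - (ξ.1 / 2 * (∫ s in τ..t, (z s).2) - ξ.2.1 / 2 * ∫ s in τ..t, (z s).1) := by
      rw [← intervalIntegral.integral_const_mul, ← intervalIntegral.integral_const_mul,
        ← intervalIntegral.integral_sub (i₂.const_mul _) (i₁.const_mul _),
        ← intervalIntegral.integral_sub i₃ ((i₂.const_mul _).sub (i₁.const_mul _))]
      congr 1
      ext s
      ring
    rw [hsplit, hxs t ht']
    simp only [Prod.fst_add, Prod.snd_add]
    ring
  have hbound : |∫ s in τ..t, ((z s).2 * ((x s).1 - ξ.1) - (z s).1 * ((x s).2.1 - ξ.2.1)) / 2|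
      ≤ (RZ * (t - τ)) ^ 2 := by
    have := intervalIntegral.norm_integral_le_of_norm_le_const (a := τ) (b := t)
      (f := fun s => ((z s).2 * ((x s).1 - ξ.1) - (z s).1 * ((x s).2.1 - ξ.2.1)) / 2)
      (C := RZ * (RZ * (t - τ))) ?_
    · rw [abs_of_nonneg (sub_nonneg.2 ht.1)] at this
      exact this.trans_eq (by ring)
    · intro s hs
      rw [uIoc_of_le ht.1] at hs
      have hs' : s ∈ Icc τ t := ⟨hs.1.le, hs.2⟩
      have b₁ : |(z s).2 * ((x s).1 - ξ.1)| ≤ RZ * (RZ * (t - τ)) := by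
        rw [abs_mul]
        exact mul_le_mul (hz₁ s hs').2 (hdisp s hs').1 (abs_nonneg _) hRZ.le
      have b₂ : |(z s).1 * ((x s).2.1 - ξ.2.1)| ≤ RZ * (RZ * (t - τ)) := by
        rw [abs_mul]
        exact mul_le_mul (hz₁ s hs').1 (hdisp s hs').2 (abs_nonneg _) hRZ.le
      rw [abs_le] at b₁ b₂
      rw [Real.norm_eq_abs, abs_le]
      constructor <;> linarith
  rw [mul_assoc]
  refine gaugeH_le hL ?_ ?_ ?_
  · rw [← abs_neg]
    convert (hdisp t ht').1 using 2
    simp only [hMul, Prod.fst_neg]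
    ring
  · rw [← abs_neg]
    convert (hdisp t ht').2 using 2
    simp only [hMul, Prod.fst_neg, Prod.snd_neg]
    ring
  · rw [← abs_neg, ← harea] at hbound
    convert hbound using 2
    simp only [hMul, Prod.fst_neg, Prod.snd_neg]
    ring
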